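/- Let Ω ⊂ R^d be bounded open with C^3 boundary, and let x₀ ∈ closure(Ω), a sequence x_k → x₀ in closure(Ω), and u⁰ a Lipschitz control with constant K₂, values in B̄(0,K₁), whose trajectory from x₀ stays in closure(Ω). Then there exist Lipschitz controls u^k with constant K₂+1, values in B̄(0,K₁+1), whose trajectories t ↦ x_k + ∫₀^t u^k stay in closure(Ω), such that u^k → u⁰ uniformly on [0,T]. -/

import Mathlib

open Set Metric MeasureTheory Filter

/-- A bounded open `C³` domain in `ℝ^(d+1)`: around every boundary point there is a `C³`
boundary-flattening diffeomorphism (with `C³` inverse) in which the domain corresponds to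
the upper half space and the boundary to the hyperplane where the last coordinate vanishes. -/
def IsC3Domain (d : ℕ) (Ω : Set (EuclideanSpace ℝ (Fin (d + 1)))) : Prop :=
  IsOpen Ω ∧ Bornology.IsBounded Ω ∧
  ∀ ξ ∈ frontier Ω,
    ∃ (U : Set (EuclideanSpace ℝ (Fin (d + 1))))
      (φ φinv : EuclideanSpace ℝ (Fin (d + 1)) → EuclideanSpace ℝ (Fin (d + 1))),
      ξ ∈ U ∧ IsOpen U ∧ IsOpen (φ '' U) ∧
      ContDiffOn ℝ 3 φ U ∧ ContDiffOn ℝ 3 φinv (φ '' U) ∧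
      (∀ x ∈ U, φinv (φ x) = x) ∧
      (∀ x ∈ U, (x ∈ closure Ω ↔ 0 ≤ φ x (Fin.last d))) ∧
      (∀ x ∈ U, (x ∈ frontier Ω ↔ φ x (Fin.last d) = 0))

lemma LipschitzOnWith.of_norm_sub_le_mul_abs {F : Type*} [NormedAddCommGroup F] {f : ℝ → F} {S : Set ℝ} {c : ℝ}
    (h : ∀ a ∈ S, ∀ b ∈ S, ‖f a - f b‖ ≤ c * |a - b|) :
    LipschitzOnWith (Real.toNNReal c) f S := by
  refine LipschitzOnWith.of_dist_le_mul fun a ha b hb => ?_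
  rw [dist_eq_norm, Real.dist_eq, Real.coe_toNNReal']
  exact (h a ha b hb).trans (by gcongr; exact le_max_left _ _)

lemma Filter.Eventually.exists_choice {ι α : Type*} {l : Filter ι} {A B : ι → α → Prop}
    (h : ∀ᶠ i in l, ∃ a, A i a ∧ B i a) (hA : ∀ i, ∃ a, A i a) :
    ∃ f : ι → α, (∀ i, A i (f i)) ∧ ∀ᶠ i in l, B i (f i) := by
  have hi : ∀ i, ∃ a, A i a ∧ ((∃ a, A i a ∧ B i a) → B i a) := fun i => by
    by_cases hi : ∃ a, A i a ∧ B i a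
    · obtain ⟨a, ha, hb⟩ := hi
      exact ⟨a, ha, fun _ => hb⟩
    · exact (hA i).imp fun a ha => ⟨ha, fun h => absurd h hi⟩
  choose f hf hfB using hi
  exact ⟨f, hf, h.mono fun i => hfB i⟩

section Analysis

variable {E F : Type*} [NormedAddCommGroup E] [NormedSpace ℝ E]
  [NormedAddCommGroup F] [NormedSpace ℝ F]

lemma norm_clm_apply_sub_apply_le (A B : E →L[ℝ] F) (x y : E) :
    ‖A x - B y‖ ≤ ‖A - B‖ * ‖x‖ + ‖B‖ * ‖x - y‖ := by
  have h : A x - B y = (A - B) x + B (x - y) := by simp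
  rw [h]
  exact (norm_add_le _ _).trans (add_le_add ((A - B).le_opNorm x) (B.le_opNorm _))

lemma ContDiffAt.exists_ball_norm_sub_le {f : E → F} {x₀ : E} (hf : ContDiffAt ℝ 1 f x₀) :
    ∃ C ≥ 0, ∃ r > 0, ∀ x ∈ ball x₀ r, ∀ x' ∈ ball x₀ r, ‖f x - f x'‖ ≤ C * ‖x - x'‖ := by
  obtain ⟨C, t, ht, hC⟩ := hf.exists_lipschitzOnWith
  obtain ⟨r, hr, hrt⟩ := Metric.mem_nhds_iff.1 ht
  refine ⟨C, C.2, r, hr, fun x hx x' hx' => ?_⟩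
  simpa [dist_eq_norm] using hC.dist_le_mul x (hrt hx) x' (hrt hx')

/-- A `C²` function vanishing for `η = 0` has Lipschitz constant `O(‖η‖)` in the first variable. -/
lemma ContDiffAt.exists_norm_sub_le_of_eventually_eq_zero {f : E × E → F} {x₀ : E}
    (hf : ContDiffAt ℝ 2 f (x₀, 0)) (h0 : ∀ᶠ x in nhds x₀, f (x, 0) = 0) :
    ∃ C ≥ 0, ∃ r > 0, ∀ x ∈ ball x₀ r, ∀ x' ∈ ball x₀ r, ∀ η ∈ ball (0 : E) r,
      ∀ η' ∈ ball (0 : E) r,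
      ‖f (x, η) - f (x', η')‖ ≤ C * (‖η‖ * ‖x - x'‖ + ‖η - η'‖) := by
  obtain ⟨C₁, hC₁, r₁, hr₁, h₁⟩ := (hf.of_le (by norm_num)).exists_ball_norm_sub_le
  obtain ⟨C₂, hC₂, r₂, hr₂, h₂⟩ :=
    (hf.fderiv_right (m := 1) (by norm_num)).exists_ball_norm_sub_le
  obtain ⟨r₃, hr₃, h₃⟩ := Metric.eventually_nhds_iff_ball.1
    (hf.eventually (by simp))
  obtain ⟨r₄, hr₄, h₄⟩ := Metric.eventually_nhds_iff_ball.1 h0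
  obtain ⟨r, hr, hr'⟩ : ∃ r > 0, r ≤ r₁ ∧ r ≤ r₂ ∧ r ≤ r₃ ∧ r ≤ r₄ :=
    ⟨min (min r₁ r₂) (min r₃ r₄), by positivity, by simp⟩
  obtain ⟨hr1, hr2, hr3, hr4⟩ := hr'
  have hmem : ∀ x ∈ ball x₀ r, ∀ η ∈ ball (0 : E) r, ∀ ρ ≥ r, (x, η) ∈ ball (x₀, (0 : E)) ρ := by
    intro x hx η hη ρ hρ
    rw [← ball_prod_same]
    exact ⟨ball_subset_ball hρ hx, ball_subset_ball hρ hη⟩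
  have h0r : (0 : E) ∈ ball (0 : E) r := mem_ball_self hr
  have hder : ∀ x ∈ ball x₀ r, ∀ η ∈ ball (0 : E) r,
      HasFDerivAt (fun x => f (x, η)) ((fderiv ℝ f (x, η)).comp (.inl ℝ E E)) x := by
    intro x hx η hη
    have := ((h₃ _ (hmem x hx η hη _ hr3)).differentiableAt (by simp)).hasFDerivAt
    exact this.comp x (hasFDerivAt_prodMk_left x η)
  have hzero : ∀ x ∈ ball x₀ r, (fderiv ℝ f (x, 0)).comp (.inl ℝ E E) = 0 := by
    intro x hx
    refine (hder x hx 0 h0r).unique ?_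
    refine (hasFDerivAt_const (0 : F) x).congr_of_eventuallyEq ?_
    filter_upwards [isOpen_ball.mem_nhds hx] with z hz using h₄ z (ball_subset_ball hr4 hz)
  refine ⟨C₁ + C₂, by positivity, r, hr, fun x hx x' hx' η hη η' hη' => ?_⟩
  have e1 : ‖f (x', η) - f (x', η')‖ ≤ C₁ * ‖η - η'‖ := by
    simpa [Prod.norm_def] using
      h₁ _ (hmem x' hx' η hη _ hr1) _ (hmem x' hx' η' hη' _ hr1)
  have e2 : ‖f (x, η) - f (x', η)‖ ≤ C₂ * ‖η‖ * ‖x - x'‖ := by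
    refine (convex_ball x₀ r).norm_image_sub_le_of_norm_hasFDerivWithin_le
      (f := fun x => f (x, η))
      (fun z hz => (hder z hz η hη).hasFDerivWithinAt) (fun z hz => ?_) hx' hx
    have e3 := h₂ _ (hmem z hz η hη _ hr2) _ (hmem z hz 0 h0r _ hr2)
    have e4 : (fderiv ℝ f (z, η)).comp (.inl ℝ E E) =
        (fderiv ℝ f (z, η) - fderiv ℝ f (z, 0)).comp (.inl ℝ E E) := by
      rw [ContinuousLinearMap.sub_comp, hzero z hz, sub_zero]
    rw [e4]
    calc _ ≤ ‖fderiv ℝ f (z, η) - fderiv ℝ f (z, 0)‖ * ‖ContinuousLinearMap.inl ℝ E E‖ :=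
          ContinuousLinearMap.opNorm_comp_le _ _
      _ ≤ ‖fderiv ℝ f (z, η) - fderiv ℝ f (z, 0)‖ * 1 := by
          gcongr; exact ContinuousLinearMap.norm_inl_le_one ℝ E E
      _ ≤ C₂ * ‖η‖ := by simpa [Prod.norm_def] using e3
  calc ‖f (x, η) - f (x', η')‖ ≤ ‖f (x, η) - f (x', η)‖ + ‖f (x', η) - f (x', η')‖ :=
        norm_sub_le_norm_sub_add_norm_sub _ _ _
    _ ≤ C₂ * ‖η‖ * ‖x - x'‖ + C₁ * ‖η - η'‖ := add_le_add e2 e1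
    _ ≤ _ := by
        have : 0 ≤ C₁ * (‖η‖ * ‖x - x'‖) := by positivity
        have : 0 ≤ C₂ * ‖η - η'‖ := by positivity
        linarith

/-- Let `G` be `C³` near `(x₀, 0)` with `G (x, 0) = 0`. Along a `C^{1,1}` curve `y` starting near
`x₀`, the curve `t ↦ G (y t, (1 - t / t₁) ^ 2 • δ)` has a derivative which is `O(‖δ‖)` in the
Lipschitz norm and vanishes at `t₁`. -/
lemma exists_small_lipschitz_velocity [CompleteSpace F] {G : E × E → F} {x₀ : E}
    (hG : ContDiffAt ℝ 3 G (x₀, 0)) (h0 : ∀ᶠ x in nhds x₀, G (x, 0) = 0)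
    {y w : ℝ → E} {K₁ K₂ : ℝ} (hK₁ : 0 ≤ K₁) (hK₂ : 0 ≤ K₂)
    (hy : ∀ t, HasDerivAt y (w t) t) (hwb : ∀ t, ‖w t‖ ≤ K₁)
    (hwl : ∀ a b, ‖w a - w b‖ ≤ K₂ * |a - b|) :
    ∃ ρ > 0, ∀ t₁ > 0, (∀ t ∈ Icc 0 t₁, y t ∈ ball x₀ ρ) → ∃ C ≥ 0, ∀ δ ∈ ball (0 : E) ρ,
      ∃ V : ℝ → F, (∀ a ∈ Icc 0 t₁, ∀ b ∈ Icc 0 t₁, ‖V a - V b‖ ≤ C * ‖δ‖ * |a - b|) ∧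
        (∀ a ∈ Icc 0 t₁, ‖V a‖ ≤ C * ‖δ‖) ∧ V t₁ = 0 ∧
        ∀ t ∈ Icc 0 t₁, ∫ τ in (0 : ℝ)..t, V τ
          = G (y t, (1 - t / t₁) ^ 2 • δ) - G (y 0, δ) := by
  have hDG : ContDiffAt ℝ 2 (fderiv ℝ G) (x₀, 0) := hG.fderiv_right (by norm_num)
  have hA : ContDiffAt ℝ 2 (fun p => (fderiv ℝ G p).comp (.inl ℝ E E)) (x₀, 0) :=
    hDG.clm_comp contDiffAt_const
  have hB : ContDiffAt ℝ 1 (fun p => (fderiv ℝ G p).comp (.inr ℝ E E)) (x₀, 0) :=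
    (hDG.clm_comp contDiffAt_const).of_le (by norm_num)
  have hGd : ∀ᶠ p in nhds (x₀, (0 : E)), DifferentiableAt ℝ G p :=
    (hG.eventually (by simp)).mono fun p hp => hp.differentiableAt (by simp)
  have hA0 : ∀ᶠ x in nhds x₀, (fderiv ℝ G (x, 0)).comp (.inl ℝ E E) = 0 := by
    have hc : Tendsto (fun x : E => (x, (0 : E))) (nhds x₀) (nhds (x₀, 0)) :=
      (by fun_prop : Continuous fun x : E => (x, (0 : E))).tendsto x₀
    filter_upwards [h0.eventually_nhds, hc.eventually hGd] with x hx hd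
    refine (hd.hasFDerivAt.comp x (hasFDerivAt_prodMk_left x 0)).unique ?_
    exact (hasFDerivAt_const (0 : F) x).congr_of_eventuallyEq hx
  obtain ⟨C₁, hC₁, r₁, hr₁, h₁⟩ := hA.exists_norm_sub_le_of_eventually_eq_zero hA0
  obtain ⟨C₂, hC₂, r₂, hr₂, h₂⟩ := hB.exists_ball_norm_sub_le
  obtain ⟨r₃, hr₃, h₃⟩ := Metric.eventually_nhds_iff_ball.1 hGd
  obtain ⟨r₄, hr₄, h₄⟩ := Metric.eventually_nhds_iff_ball.1 hA0
  obtain ⟨ρ, hρ, hρ1, hρ2, hρ3, hρ4⟩ : ∃ r > 0, r ≤ r₁ ∧ r ≤ r₂ ∧ r ≤ r₃ ∧ r ≤ r₄ :=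
    ⟨min (min r₁ r₂) (min r₃ r₄), by positivity, by simp⟩
  refine ⟨ρ, hρ, fun t₁ ht₁ hyb => ?_⟩
  set M : ℝ := ‖(fderiv ℝ G (x₀, 0)).comp (.inr ℝ E E)‖ + C₂ * ρ with hM
  have hM0 : 0 ≤ M := by positivity
  set D : ℝ := C₂ * (K₁ + ρ * (2 / t₁)) with hD
  have hD0 : 0 ≤ D := by positivity
  refine ⟨(C₁ * (K₁ + 2 / t₁) * K₁ + C₁ * K₂ + D * (2 / t₁) + M * (2 / t₁ ^ 2))
    + (C₁ * K₁ + M * (2 / t₁)), by positivity, fun δ hδ => ?_⟩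
  have hδρ : ‖δ‖ < ρ := by simpa using hδ
  set s : ℝ → ℝ := fun t => (1 - t / t₁) ^ 2 with hs
  set s' : ℝ → ℝ := fun t => -(2 / t₁) * (1 - t / t₁) with hs'
  set A : ℝ → E →L[ℝ] F := fun t => (fderiv ℝ G (y t, s t • δ)).comp (.inl ℝ E E) with hAdef
  set B : ℝ → E →L[ℝ] F := fun t => (fderiv ℝ G (y t, s t • δ)).comp (.inr ℝ E E) with hBdef
  have hq : ∀ t ∈ Icc 0 t₁, 0 ≤ 1 - t / t₁ ∧ 1 - t / t₁ ≤ 1 := fun t ht => by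
    have h1 : t / t₁ ≤ 1 := (div_le_one ht₁).2 ht.2
    have h2 : 0 ≤ t / t₁ := div_nonneg ht.1 ht₁.le
    constructor <;> linarith
  have hsb : ∀ t ∈ Icc 0 t₁, |s t| ≤ 1 := fun t ht => by
    rw [abs_of_nonneg (sq_nonneg _)]
    exact pow_le_one₀ (hq t ht).1 (hq t ht).2
  have hsδ : ∀ t ∈ Icc 0 t₁, ‖s t • δ‖ ≤ ‖δ‖ := fun t ht => by
    rw [norm_smul]
    exact mul_le_of_le_one_left (norm_nonneg _) (hsb t ht)
  have hsball : ∀ t ∈ Icc 0 t₁, s t • δ ∈ ball (0 : E) ρ := fun t ht => by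
    simpa using (hsδ t ht).trans_lt hδρ
  have hs'b : ∀ t ∈ Icc 0 t₁, |s' t| ≤ 2 / t₁ := fun t ht => by
    rw [abs_mul, abs_neg, abs_of_pos (by positivity : 0 < 2 / t₁), abs_of_nonneg (hq t ht).1]
    exact mul_le_of_le_one_right (by positivity) (hq t ht).2
  have hsl : ∀ a ∈ Icc 0 t₁, ∀ b ∈ Icc 0 t₁, |s a - s b| ≤ 2 / t₁ * |a - b| := by
    intro a ha b hb
    have e : s a - s b = -(1 / t₁) * ((1 - a / t₁) + (1 - b / t₁)) * (a - b) := by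
      simp only [hs]; field_simp; ring
    rw [e, abs_mul, abs_mul, abs_neg, abs_of_pos (by positivity : 0 < 1 / t₁),
      abs_of_nonneg (add_nonneg (hq a ha).1 (hq b hb).1)]
    have : (1 - a / t₁) + (1 - b / t₁) ≤ 2 := by linarith [(hq a ha).2, (hq b hb).2]
    calc _ ≤ 1 / t₁ * 2 * |a - b| := by gcongr
      _ = _ := by ring
  have hs'l : ∀ a b, |s' a - s' b| = 2 / t₁ ^ 2 * |a - b| := by
    intro a b
    have e : s' a - s' b = 2 / t₁ ^ 2 * (a - b) := by simp only [hs']; field_simp; ring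
    rw [e, abs_mul, abs_of_pos (by positivity)]
  have hyl : ∀ a b, ‖y a - y b‖ ≤ K₁ * |a - b| := fun a b =>
    convex_univ.norm_image_sub_le_of_norm_hasDerivWithin_le
      (fun t _ => (hy t).hasDerivWithinAt) (fun t _ => hwb t) (mem_univ b) (mem_univ a)
  have hAl : ∀ a ∈ Icc 0 t₁, ∀ b ∈ Icc 0 t₁,
      ‖A a - A b‖ ≤ C₁ * (K₁ + 2 / t₁) * ‖δ‖ * |a - b| := by
    intro a ha b hb
    refine (h₁ _ (ball_subset_ball hρ1 (hyb a ha)) _ (ball_subset_ball hρ1 (hyb b hb))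
      _ (ball_subset_ball hρ1 (hsball a ha)) _ (ball_subset_ball hρ1 (hsball b hb))).trans ?_
    rw [← sub_smul, norm_smul (s a - s b), Real.norm_eq_abs]
    calc _ ≤ C₁ * (‖δ‖ * (K₁ * |a - b|) + 2 / t₁ * |a - b| * ‖δ‖) := by
          gcongr
          exacts [hsδ a ha, hyl a b, hsl a ha b hb]
      _ = _ := by ring
  have hAb : ∀ a ∈ Icc 0 t₁, ‖A a‖ ≤ C₁ * ‖δ‖ := by
    intro a ha
    have e := h₁ _ (ball_subset_ball hρ1 (hyb a ha)) _ (ball_subset_ball hρ1 (hyb a ha))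
      _ (ball_subset_ball hρ1 (hsball a ha)) 0 (mem_ball_self hr₁)
    rw [h₄ _ (ball_subset_ball hρ4 (hyb a ha))] at e
    simp only [sub_zero, sub_self, norm_zero, mul_zero, zero_add] at e
    exact e.trans (by gcongr; exact hsδ a ha)
  have hmem : ∀ t ∈ Icc 0 t₁, ∀ r ≥ ρ, (y t, s t • δ) ∈ ball (x₀, (0 : E)) r := by
    intro t ht r hr
    rw [← ball_prod_same]
    exact ⟨ball_subset_ball hr (hyb t ht), ball_subset_ball hr (hsball t ht)⟩
  have hBl : ∀ a ∈ Icc 0 t₁, ∀ b ∈ Icc 0 t₁, ‖B a - B b‖ ≤ D * |a - b| := by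
    intro a ha b hb
    refine (h₂ _ (hmem a ha _ hρ2) _ (hmem b hb _ hρ2)).trans ?_
    rw [hD, mul_assoc]
    gcongr
    rw [Prod.mk_sub_mk, ← sub_smul]
    refine (max_le_add_of_nonneg (norm_nonneg _) (norm_nonneg _)).trans ?_
    rw [norm_smul (s a - s b), Real.norm_eq_abs]
    calc _ ≤ K₁ * |a - b| + 2 / t₁ * |a - b| * ρ := by
          gcongr
          exacts [hyl a b, hsl a ha b hb]
      _ = _ := by ring
  have hBb : ∀ a ∈ Icc 0 t₁, ‖B a‖ ≤ M := by
    intro a ha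
    have e := h₂ _ (hmem a ha _ hρ2) (x₀, 0) (mem_ball_self hr₂)
    have e2 : ‖(y a, s a • δ) - (x₀, (0 : E))‖ ≤ ρ := by
      simpa [dist_eq_norm] using (mem_ball.1 (hmem a ha ρ le_rfl)).le
    have e3 : ‖B a‖ ≤ ‖B a - (fderiv ℝ G (x₀, 0)).comp (.inr ℝ E E)‖
        + ‖(fderiv ℝ G (x₀, 0)).comp (.inr ℝ E E)‖ := norm_le_norm_sub_add _ _
    have e4 := mul_le_mul_of_nonneg_left e2 hC₂
    linarith [e.trans e4]
  have hVeq : ∀ t, fderiv ℝ G (y t, s t • δ) (w t, s' t • δ) = A t (w t) + B t (s' t • δ) := by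
    intro t
    simp only [hAdef, hBdef, ContinuousLinearMap.comp_apply, ContinuousLinearMap.inl_apply,
      ContinuousLinearMap.inr_apply, ← map_add, Prod.mk_add_mk, add_zero, zero_add]
  have hVl : ∀ a ∈ Icc 0 t₁, ∀ b ∈ Icc 0 t₁,
      ‖(A a (w a) + B a (s' a • δ)) - (A b (w b) + B b (s' b • δ))‖ ≤
      (C₁ * (K₁ + 2 / t₁) * K₁ + C₁ * K₂ + D * (2 / t₁) + M * (2 / t₁ ^ 2)) * ‖δ‖ * |a - b| := by
    intro a ha b hb
    rw [add_sub_add_comm]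
    have e1 := norm_clm_apply_sub_apply_le (A a) (A b) (w a) (w b)
    have e2 := norm_clm_apply_sub_apply_le (B a) (B b) (s' a • δ) (s' b • δ)
    rw [← sub_smul, norm_smul, norm_smul, Real.norm_eq_abs, Real.norm_eq_abs, hs'l] at e2
    calc _ ≤ _ := (norm_add_le _ _).trans (add_le_add e1 e2)
      _ ≤ (C₁ * (K₁ + 2 / t₁) * ‖δ‖ * |a - b| * K₁ + C₁ * ‖δ‖ * (K₂ * |a - b|)) +
          (D * |a - b| * (2 / t₁ * ‖δ‖) + M * (2 / t₁ ^ 2 * |a - b| * ‖δ‖)) := by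
          gcongr
          exacts [hAl a ha b hb, hwb a, hAb b hb, hwl a b, hBl a ha b hb, hs'b a ha, hBb b hb]
      _ = _ := by ring
  refine ⟨fun t => A t (w t) + B t (s' t • δ), fun a ha b hb => ?_, fun a ha => ?_, ?_,
    fun t ht => ?_⟩
  · refine (hVl a ha b hb).trans ?_
    refine mul_le_mul_of_nonneg_right (mul_le_mul_of_nonneg_right ?_ (norm_nonneg _))
      (abs_nonneg _)
    exact le_add_of_nonneg_right (by positivity)
  · calc _ ≤ ‖A a‖ * ‖w a‖ + ‖B a‖ * ‖s' a • δ‖ := (norm_add_le _ _).trans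
          (add_le_add ((A a).le_opNorm _) ((B a).le_opNorm _))
      _ ≤ C₁ * ‖δ‖ * K₁ + M * (2 / t₁ * ‖δ‖) := by
          rw [norm_smul, Real.norm_eq_abs]
          gcongr
          exacts [hAb a ha, hwb a, hBb a ha, hs'b a ha]
      _ = (C₁ * K₁ + M * (2 / t₁)) * ‖δ‖ := by ring
      _ ≤ _ := by
          refine mul_le_mul_of_nonneg_right ?_ (norm_nonneg _)
          exact le_add_of_nonneg_left (by positivity)
  · have hz : s t₁ = 0 := by simp [s, ht₁.ne']
    have hz' : s' t₁ = 0 := by simp [s', ht₁.ne']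
    have hAz : A t₁ = 0 := by
      simp only [hAdef, hz, zero_smul]
      exact h₄ _ (ball_subset_ball hρ4 (hyb t₁ ⟨ht₁.le, le_rfl⟩))
    simp [hz', hAz]
  · have hsub : Set.uIcc 0 t ⊆ Icc 0 t₁ := by
      rw [uIcc_of_le ht.1]; exact Icc_subset_Icc_right ht.2
    have hder : ∀ τ ∈ Set.uIcc 0 t, HasDerivAt (fun τ => G (y τ, s τ • δ))
        (A τ (w τ) + B τ (s' τ • δ)) τ := by
      intro τ hτ
      rw [← hVeq]
      have hsd : HasDerivAt s (s' τ) τ := by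
        have := (((hasDerivAt_id τ).div_const t₁).const_sub 1).pow 2
        refine this.congr_deriv ?_
        simp only [hs']; simp; ring
      exact (h₃ _ (hmem τ (hsub hτ) _ hρ3)).hasFDerivAt.comp_hasDerivAt τ
        ((hy τ).prodMk (hsd.smul_const δ))
    have hcont : ContinuousOn (fun τ => A τ (w τ) + B τ (s' τ • δ)) (Set.uIcc 0 t) := by
      exact (LipschitzOnWith.of_norm_sub_le_mul_abs hVl).continuousOn.mono hsub
    rw [intervalIntegral.integral_eq_sub_of_hasDerivAt hder hcont.intervalIntegrable]
    simp [hs]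

/-- `G (x, η) = ψ (φ x + η) - x` translates `x` by `η` in the chart `φ` with inverse `ψ`. -/
lemma exists_chart_translation {U S : Set E} {φ ψ : E → E} {x₀ : E} (hxU : x₀ ∈ U)
    (hU : IsOpen U) (hφU : IsOpen (φ '' U)) (hφ : ContDiffOn ℝ 3 φ U)
    (hψ : ContDiffOn ℝ 3 ψ (φ '' U)) (hinv : ∀ x ∈ U, ψ (φ x) = x)
    (hS : ∀ x ∈ U ∩ S, ∀ q ∈ U ∩ S, ∀ z ∈ U, ∀ s ∈ Icc (0 : ℝ) 1,
      φ z = φ x + s • (φ q - φ x₀) → z ∈ S) :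
    ∃ (φ : E → E) (G : E × E → E), ContinuousAt φ x₀ ∧ ContDiffAt ℝ 3 G (x₀, 0) ∧
      ∃ r > 0, (∀ x ∈ ball x₀ r, G (x, 0) = 0) ∧
        (∀ q ∈ ball x₀ r, G (x₀, φ q - φ x₀) = q - x₀) ∧
        ∀ x ∈ ball x₀ r ∩ S, ∀ q ∈ ball x₀ r ∩ S, ∀ s ∈ Icc (0 : ℝ) 1,
          x + G (x, s • (φ q - φ x₀)) ∈ S := by
  have hφx : ContDiffAt ℝ 3 φ x₀ := hφ.contDiffAt (hU.mem_nhds hxU)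
  have hψx : ContDiffAt ℝ 3 ψ (φ x₀) := hψ.contDiffAt (hφU.mem_nhds ⟨x₀, hxU, rfl⟩)
  refine ⟨φ, fun p => ψ (φ p.1 + p.2) - p.1, hφx.continuousAt, ?_, ?_⟩
  · have h1 : ContDiffAt ℝ 3 (fun p : E × E => φ p.1 + p.2) (x₀, 0) :=
      (ContDiffAt.comp (x₀, (0 : E)) (f := Prod.fst) hφx contDiffAt_fst).add contDiffAt_snd
    refine ContDiffAt.sub ?_ contDiffAt_fst
    exact ContDiffAt.comp (x₀, (0 : E)) (by simpa using hψx) h1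
  · obtain ⟨ε, hε, hεU⟩ := Metric.isOpen_iff.1 hφU _ ⟨x₀, hxU, rfl⟩
    obtain ⟨r₁, hr₁, h₁⟩ := Metric.isOpen_iff.1 hU _ hxU
    obtain ⟨r₂, hr₂, h₂⟩ := Metric.continuousAt_iff.1 hφx.continuousAt (ε / 2) (by positivity)
    refine ⟨min r₁ r₂, by positivity, fun x hx => ?_, fun q hq => ?_, ?_⟩
    · simp [hinv x (h₁ (ball_subset_ball (min_le_left _ _) hx))]
    · simp [hinv q (h₁ (ball_subset_ball (min_le_left _ _) hq))]
    · rintro x ⟨hx, hxS⟩ q ⟨hq, hqS⟩ s hs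
      have hxd := h₂ (ball_subset_ball (min_le_right _ _) hx)
      have hqd := h₂ (ball_subset_ball (min_le_right _ _) hq)
      have hmem : φ x + s • (φ q - φ x₀) ∈ ball (φ x₀) ε := by
        rw [dist_eq_norm] at hxd hqd
        rw [mem_ball, dist_eq_norm, add_sub_right_comm]
        refine (norm_add_le _ _).trans_lt ?_
        rw [norm_smul, Real.norm_of_nonneg hs.1]
        have := mul_le_of_le_one_left (norm_nonneg (φ q - φ x₀)) hs.2
        linarith
      obtain ⟨z, hz, hzeq⟩ := hεU hmem
      have := hS x ⟨h₁ (ball_subset_ball (min_le_left _ _) hx), hxS⟩ q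
        ⟨h₁ (ball_subset_ball (min_le_left _ _) hq), hqS⟩ z hz s hs hzeq
      simpa [← hzeq, hinv z hz] using this

end Analysis

lemma IsC3Domain.exists_local_translation {d : ℕ} {Ω : Set (EuclideanSpace ℝ (Fin (d + 1)))}
    (hΩ : IsC3Domain d Ω) {x₀ : EuclideanSpace ℝ (Fin (d + 1))} (hx₀ : x₀ ∈ closure Ω) :
    ∃ (φ : EuclideanSpace ℝ (Fin (d + 1)) → EuclideanSpace ℝ (Fin (d + 1)))
      (G : EuclideanSpace ℝ (Fin (d + 1)) × EuclideanSpace ℝ (Fin (d + 1)) →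
        EuclideanSpace ℝ (Fin (d + 1))),
      ContinuousAt φ x₀ ∧ ContDiffAt ℝ 3 G (x₀, 0) ∧
      ∃ r > 0, (∀ x ∈ ball x₀ r, G (x, 0) = 0) ∧
        (∀ q ∈ ball x₀ r, G (x₀, φ q - φ x₀) = q - x₀) ∧
        ∀ x ∈ ball x₀ r ∩ closure Ω, ∀ q ∈ ball x₀ r ∩ closure Ω, ∀ s ∈ Icc (0 : ℝ) 1,
          x + G (x, s • (φ q - φ x₀)) ∈ closure Ω := by
  obtain ⟨hopen, -, hbd⟩ := hΩ
  by_cases hx : x₀ ∈ Ω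
  · exact exists_chart_translation (φ := id) (ψ := id) hx hopen (by simpa) contDiffOn_id
      contDiffOn_id (fun _ _ => rfl) fun _ _ _ _ z hz _ _ _ => subset_closure hz
  · obtain ⟨U, φ, ψ, hξ, hU, hφU, hφ, hψ, hinv, hcl, hfr⟩ :=
      hbd x₀ (hopen.frontier_eq ▸ ⟨hx₀, hx⟩)
    refine exists_chart_translation hξ hU hφU hφ hψ hinv ?_
    rintro x ⟨hxU, hxS⟩ q ⟨hqU, hqS⟩ z hz s hs hzeq
    have h0 : φ x₀ (Fin.last d) = 0 := (hfr x₀ hξ).1 (hopen.frontier_eq ▸ ⟨hx₀, hx⟩)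
    rw [hcl z hz, hzeq]
    have h1 := (hcl x hxU).1 hxS
    have h2 := mul_nonneg hs.1 ((hcl q hqU).1 hqS)
    simpa [h0] using add_nonneg h1 h2

/-- Every admissible control from `x₀` can be corrected by a perturbation, small in the Lipschitz
norm, into an admissible control from any nearby starting point. -/
lemma IsC3Domain.exists_small_correction {d : ℕ} {Ω : Set (EuclideanSpace ℝ (Fin (d + 1)))}
    (hΩ : IsC3Domain d Ω) {T K₁ K₂ : ℝ} (hT : 0 < T) (hK₁ : 0 < K₁) (hK₂ : 0 ≤ K₂)
    {x₀ : EuclideanSpace ℝ (Fin (d + 1))} (hx₀ : x₀ ∈ closure Ω)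
    {w : ℝ → EuclideanSpace ℝ (Fin (d + 1))} (hwb : ∀ t, ‖w t‖ ≤ K₁)
    (hwl : ∀ a b, ‖w a - w b‖ ≤ K₂ * |a - b|)
    (hadm : ∀ t ∈ Icc 0 T, x₀ + ∫ τ in (0 : ℝ)..t, w τ ∈ closure Ω) :
    ∃ e : EuclideanSpace ℝ (Fin (d + 1)) → ℝ, Tendsto e (nhds x₀) (nhds 0) ∧
      ∀ᶠ q in nhds x₀, q ∈ closure Ω → ∃ v : ℝ → EuclideanSpace ℝ (Fin (d + 1)),
        (∀ a ∈ Icc 0 T, ∀ b ∈ Icc 0 T, ‖v a - v b‖ ≤ e q * |a - b|) ∧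
        (∀ a ∈ Icc 0 T, ‖v a‖ ≤ e q) ∧
        ∀ t ∈ Icc 0 T, q + ∫ τ in (0 : ℝ)..t, (w τ + v τ) ∈ closure Ω := by
  obtain ⟨φ, G, hφ, hG, r, hr, hG0, hGq, hGS⟩ := hΩ.exists_local_translation hx₀
  have hwc : Continuous w :=
    lipschitzOnWith_univ.1 (LipschitzOnWith.of_norm_sub_le_mul_abs
      (S := univ) fun a _ b _ => hwl a b) |>.continuous
  set y : ℝ → EuclideanSpace ℝ (Fin (d + 1)) := fun t => x₀ + ∫ τ in (0 : ℝ)..t, w τ with hydef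
  have hy : ∀ t, HasDerivAt y (w t) t := fun t =>
    ((hwc.integral_hasStrictDerivAt 0 t).hasDerivAt).const_add x₀
  have hy0 : y 0 = x₀ := by simp [hydef]
  obtain ⟨ρ, hρ, H⟩ := exists_small_lipschitz_velocity hG
    (Metric.eventually_nhds_iff_ball.2 ⟨r, hr, hG0⟩) hK₁.le hK₂ hy hwb hwl
  set t₁ : ℝ := min T (min ρ r / (2 * K₁)) with ht₁def
  have ht₁ : 0 < t₁ := by positivity
  have ht₁T : t₁ ≤ T := min_le_left _ _
  have hyball : ∀ t ∈ Icc 0 t₁, y t ∈ ball x₀ (min ρ r) := by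
    intro t ht
    have e1 : ‖∫ τ in (0 : ℝ)..t, w τ‖ ≤ K₁ * |t - 0| :=
      intervalIntegral.norm_integral_le_of_norm_le_const fun τ _ => hwb τ
    have e2 : t ≤ min ρ r / (2 * K₁) := ht.2.trans (min_le_right _ _)
    rw [le_div_iff₀ (by positivity)] at e2
    rw [sub_zero, abs_of_nonneg ht.1] at e1
    rw [mem_ball, dist_eq_norm]
    simp only [hydef, add_sub_cancel_left]
    have : 0 < min ρ r := by positivity
    linarith
  obtain ⟨C, hC, H⟩ := H t₁ ht₁ fun t ht => ball_subset_ball (min_le_left _ _) (hyball t ht)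
  have hδ : Tendsto (fun q => φ q - φ x₀) (nhds x₀) (nhds 0) := by
    simpa using hφ.tendsto.sub_const (φ x₀)
  refine ⟨fun q => C * ‖φ q - φ x₀‖, by simpa using hδ.norm.const_mul C, ?_⟩
  filter_upwards [hδ.eventually (ball_mem_nhds 0 hρ), ball_mem_nhds x₀ hr] with q hqρ hqr hqS
  obtain ⟨V, hVl, hVb, hV1, hVi⟩ := H _ hqρ
  have hclip : ∀ t ∈ Icc 0 T, min t t₁ ∈ Icc 0 t₁ := fun t ht =>
    ⟨le_min ht.1 ht₁.le, min_le_right _ _⟩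
  have hvl : ∀ a ∈ Icc 0 T, ∀ b ∈ Icc 0 T,
      ‖V (min a t₁) - V (min b t₁)‖ ≤ C * ‖φ q - φ x₀‖ * |a - b| := fun a ha b hb =>
    (hVl _ (hclip a ha) _ (hclip b hb)).trans
      (mul_le_mul_of_nonneg_left (abs_inf_sub_inf_le_abs a b t₁) (by positivity))
  refine ⟨fun t => V (min t t₁), hvl, fun a ha => hVb _ (hclip a ha), fun t ht => ?_⟩
  have hvi : ∀ a ∈ Icc 0 T, ∀ b ∈ Icc 0 T,
      IntervalIntegrable (fun t => V (min t t₁)) volume a b := fun a ha b hb =>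
    ((LipschitzOnWith.of_norm_sub_le_mul_abs hvl).continuousOn.mono
      (ordConnected_Icc.uIcc_subset ha hb)).intervalIntegrable
  have h0T : (0 : ℝ) ∈ Icc 0 T := ⟨le_rfl, hT.le⟩
  have hint : ∀ t ∈ Icc 0 t₁, ∫ τ in (0 : ℝ)..t, V (min τ t₁) =
      G (y t, (1 - t / t₁) ^ 2 • (φ q - φ x₀)) - (q - x₀) := by
    intro t ht
    have hVt := hVi t ht
    rw [hy0, hGq q hqr] at hVt
    rw [← hVt]
    refine intervalIntegral.integral_congr fun τ hτ => ?_
    rw [uIcc_of_le ht.1] at hτ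
    simp only [min_eq_left (hτ.2.trans ht.2)]
  rw [intervalIntegral.integral_add (hwc.intervalIntegrable _ _) (hvi 0 h0T t ht)]
  rcases le_total t t₁ with htt | htt
  · have htI : t ∈ Icc 0 t₁ := ⟨ht.1, htt⟩
    have hs : (1 - t / t₁) ^ 2 ∈ Icc (0 : ℝ) 1 := by
      have h1 : t / t₁ ≤ 1 := (div_le_one ht₁).2 htt
      have h2 : 0 ≤ t / t₁ := div_nonneg ht.1 ht₁.le
      exact ⟨sq_nonneg _, pow_le_one₀ (by linarith) (by linarith)⟩
    have := hGS (y t) ⟨ball_subset_ball (min_le_right _ _) (hyball t htI), hadm t ht⟩ q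
      ⟨hqr, hqS⟩ _ hs
    rw [hint t htI]
    convert this using 1
    simp only [hydef]
    abel
  · have h1I : t₁ ∈ Icc 0 t₁ := ⟨ht₁.le, le_rfl⟩
    have h1T : t₁ ∈ Icc 0 T := ⟨ht₁.le, ht₁T⟩
    have hz : ∫ τ in t₁..t, V (min τ t₁) = 0 := by
      rw [← intervalIntegral.integral_zero (a := t₁) (b := t) (μ := volume)]
      refine intervalIntegral.integral_congr fun τ hτ => ?_
      rw [uIcc_of_le htt] at hτ
      simp only [min_eq_right hτ.1, hV1]
    rw [← intervalIntegral.integral_add_adjacent_intervals (hvi 0 h0T _ h1T) (hvi _ h1T t ht),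
      hz, hint t₁ h1I, div_self ht₁.ne', sub_self, zero_pow two_ne_zero, zero_smul,
      hG0 _ (ball_subset_ball (min_le_right _ _) (hyball t₁ h1I))]
    convert hadm t ht using 1
    abel

/-- Approximation of constrained paths. Given a bounded `C³` domain `Ω`,
`x₀ ∈ closure Ω`, a sequence `x_k → x₀` in `closure Ω`, and a `K₂`-Lipschitz control
`u⁰ : [0,T] → B̄(0,K₁)` whose trajectory from `x₀` stays in `closure Ω`, there exist
`(K₂+1)`-Lipschitz controls `u^k` with values in `B̄(0,K₁+1)` whose trajectories from `x_k`
stay in `closure Ω`, with `u^k → u⁰` uniformly on `[0,T]`. -/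
theorem stmt16 (d : ℕ) (Ω : Set (EuclideanSpace ℝ (Fin (d + 1))))
    (hΩ : IsC3Domain d Ω)
    (T K₁ K₂ : ℝ) (hT : 0 < T) (hK₁ : 0 < K₁) (hK₂ : 0 < K₂)
    (x₀ : EuclideanSpace ℝ (Fin (d + 1))) (hx₀ : x₀ ∈ closure Ω)
    (xk : ℕ → EuclideanSpace ℝ (Fin (d + 1))) (hxk : ∀ k, xk k ∈ closure Ω)
    (hconv : Tendsto xk atTop (nhds x₀))
    (u0 : ℝ → EuclideanSpace ℝ (Fin (d + 1)))
    (hu0lip : LipschitzOnWith (Real.toNNReal K₂) u0 (Set.Icc (0:ℝ) T))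
    (hu0ball : ∀ t ∈ Set.Icc (0:ℝ) T, ‖u0 t‖ ≤ K₁)
    (hu0adm : ∀ t ∈ Set.Icc (0:ℝ) T, x₀ + ∫ τ in (0:ℝ)..t, u0 τ ∈ closure Ω) :
    ∃ u : ℕ → ℝ → EuclideanSpace ℝ (Fin (d + 1)),
      (∀ k, LipschitzOnWith (Real.toNNReal (K₂ + 1)) (u k) (Set.Icc (0:ℝ) T)) ∧
      (∀ k, ∀ t ∈ Set.Icc (0:ℝ) T, ‖u k t‖ ≤ K₁ + 1) ∧
      (∀ k, ∀ t ∈ Set.Icc (0:ℝ) T, xk k + ∫ τ in (0:ℝ)..t, u k τ ∈ closure Ω) ∧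
      TendstoUniformlyOn u u0 atTop (Set.Icc (0:ℝ) T) := by
  have hwb : ∀ t, ‖u0 (projIcc 0 T hT.le t)‖ ≤ K₁ := fun t => hu0ball _ (projIcc 0 T hT.le t).2
  have hwl : ∀ a b, ‖u0 (projIcc 0 T hT.le a) - u0 (projIcc 0 T hT.le b)‖ ≤ K₂ * |a - b| := by
    intro a b
    have h1 := hu0lip.dist_le_mul _ (projIcc 0 T hT.le a).2 _ (projIcc 0 T hT.le b).2
    rw [dist_eq_norm, Real.coe_toNNReal _ hK₂.le] at h1
    have h2 := (LipschitzWith.projIcc hT.le).dist_le_mul a b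
    rw [NNReal.coe_one, one_mul, Real.dist_eq] at h2
    exact h1.trans (mul_le_mul_of_nonneg_left h2 hK₂.le)
  have hw : ∀ t ∈ Icc 0 T, u0 (projIcc 0 T hT.le t) = u0 t := fun t ht => by
    rw [projIcc_of_mem hT.le ht]
  have hsub : ∀ t ∈ Icc 0 T, uIcc 0 t ⊆ Icc 0 T := fun t ht =>
    ordConnected_Icc.uIcc_subset ⟨le_rfl, hT.le⟩ ht
  obtain ⟨e, he, H⟩ := hΩ.exists_small_correction hT hK₁ hK₂.le hx₀ hwb hwl fun t ht => by
    rw [intervalIntegral.integral_congr fun τ hτ => hw τ (hsub t ht hτ)]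
    exact hu0adm t ht
  have he' := he.comp hconv
  have hgood : ∀ᶠ k in atTop, ∃ u : ℝ → EuclideanSpace ℝ (Fin (d + 1)),
      (LipschitzOnWith (Real.toNNReal (K₂ + 1)) u (Icc 0 T) ∧
      (∀ t ∈ Icc 0 T, ‖u t‖ ≤ K₁ + 1) ∧
      (∀ t ∈ Icc 0 T, xk k + ∫ τ in (0 : ℝ)..t, u τ ∈ closure Ω)) ∧
      ∀ t ∈ Icc 0 T, ‖u0 t - u t‖ ≤ e (xk k) := by
    filter_upwards [hconv.eventually H, he'.eventually (ge_mem_nhds one_pos)] with k hk he1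
    obtain ⟨v, hvl, hvb, hva⟩ := hk (hxk k)
    refine ⟨fun t => u0 (projIcc 0 T hT.le t) + v t,
      ⟨LipschitzOnWith.of_norm_sub_le_mul_abs fun a ha b hb => ?_, fun t ht => ?_, hva⟩,
      fun t ht => ?_⟩
    · rw [add_sub_add_comm, add_mul]
      exact (norm_add_le _ _).trans (add_le_add (hwl a b)
        ((hvl a ha b hb).trans (mul_le_mul_of_nonneg_right he1 (abs_nonneg _))))
    · exact (norm_add_le _ _).trans (add_le_add (hwb t) ((hvb t ht).trans he1))
    · simpa [hw t ht] using hvb t ht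
  obtain ⟨u, hu, hue⟩ := hgood.exists_choice fun k =>
    ⟨0, (LipschitzWith.const 0).lipschitzOnWith.weaken zero_le,
      fun t _ => by simpa using by positivity, fun t _ => by simpa using hxk k⟩
  refine ⟨u, fun k => (hu k).1, fun k => (hu k).2.1, fun k => (hu k).2.2,
    Metric.tendstoUniformlyOn_iff.2 fun ε hε => ?_⟩
  filter_upwards [hue, he'.eventually (gt_mem_nhds hε)] with k h1 h2 t ht
  rw [dist_eq_norm]
  exact (h1 t ht).trans_lt h2
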